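/- For all ξ₁, η₁, ξ₂, η₂ ∈ C_c²((0,∞)): ∫₀^∞ ∫_ℝ (−(2πi)⁻¹ · a · (∂/∂b)(ξ₁ *₊ η₁)(b,a)) · (ξ₂ *₊ η₂)(b,a) db a⁻² da = 0, and likewise ∫₀^∞ ∫_ℝ (−(2πi)⁻¹ · a · (∂/∂b)(ξ₁ *₋ η₁)(b,a)) · (ξ₂ *₋ η₂)(b,a) db a⁻² da = 0; in both cases the integrand is integrable. -/

import Mathlib

open MeasureTheory Set

/-- Coefficient function of the representation `π₊` of the real `ax+b` group:
`(ξ *₊ η)(b,a) = ∫₀^∞ e^{-2πibt} ξ(at) conj(η(t)) t⁻¹ dt`. -/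
noncomputable def coeffP (ξ η : ℝ → ℂ) (b a : ℝ) : ℂ :=
  ∫ t in Ioi (0 : ℝ),
    Complex.exp (-(2 * Real.pi * b * t : ℝ) * Complex.I) * ξ (a * t)
      * starRingEnd ℂ (η t) * (t : ℂ)⁻¹

/-- Coefficient function of the representation `π₋` of the real `ax+b` group:
`(ξ *₋ η)(b,a) = ∫₀^∞ e^{2πibt} ξ(at) conj(η(t)) t⁻¹ dt`. -/
noncomputable def coeffM (ξ η : ℝ → ℂ) (b a : ℝ) : ℂ :=
  ∫ t in Ioi (0 : ℝ),
    Complex.exp ((2 * Real.pi * b * t : ℝ) * Complex.I) * ξ (a * t)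
      * starRingEnd ℂ (η t) * (t : ℂ)⁻¹

/-- `C_c²((0,∞))`: twice continuously differentiable complex-valued functions on `ℝ`
with compact support contained in `(0,∞)`. -/
def CcTwo (f : ℝ → ℂ) : Prop :=
  ContDiff ℝ 2 f ∧ HasCompactSupport f ∧ tsupport f ⊆ Ioi (0 : ℝ)

/-- Left Haar measure `a⁻² db da` of the `ax+b` group, modelled on `ℝ × (0,∞)`
(first coordinate `b`, second coordinate `a`). -/
noncomputable def muG : Measure (ℝ × ℝ) :=
  (((volume : Measure ℝ).prod ((volume : Measure ℝ).restrict (Ioi (0 : ℝ)))).withDensity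
    fun p => ENNReal.ofReal ((p.2 ^ 2)⁻¹))

open FourierTransform

namespace CcTwo

variable {f u v : ℝ → ℂ}

lemma continuous (hf : CcTwo f) : Continuous f := hf.1.continuous

lemma integrable (hf : CcTwo f) : Integrable f :=
  hf.continuous.integrable_of_hasCompactSupport hf.2.1

lemma eq_zero_of_nonpos (hf : CcTwo f) {t : ℝ} (ht : t ≤ 0) : f t = 0 :=
  image_eq_zero_of_notMem_tsupport fun h => not_lt.2 ht (hf.2.2 h)

lemma conj (hf : CcTwo f) : CcTwo fun t => starRingEnd ℂ (f t) := by
  have hs : tsupport (fun t => starRingEnd ℂ (f t)) = tsupport f := by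
    simp only [tsupport]
    congr 1
    ext t
    simp
  refine ⟨Complex.conjCLE.contDiff.comp hf.1, ?_, hs ▸ hf.2.2⟩
  rw [HasCompactSupport, hs]
  exact hf.2.1

lemma mul (hu : CcTwo u) (hv : ContDiff ℝ 2 v) : CcTwo fun t => u t * v t :=
  ⟨hu.1.mul hv, hu.2.1.mul_right, (tsupport_mul_subset_left).trans hu.2.2⟩

lemma mul_slice (hu : CcTwo u) (hv : CcTwo v) (a : ℝ) : CcTwo fun t => u t * v (a * t) :=
  hu.mul (hv.1.comp (contDiff_const.mul contDiff_id))

lemma mul_inv (hu : CcTwo u) : CcTwo fun t => u t * (t : ℂ)⁻¹ := by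
  refine ⟨contDiff_iff_contDiffAt.2 fun t => ?_, hu.2.1.mul_right,
    (tsupport_mul_subset_left).trans hu.2.2⟩
  by_cases ht : t = 0
  · have h0 : t ∉ tsupport u := fun h => (hu.2.2 h).ne' ht
    refine (contDiffAt_const (c := (0 : ℂ))).congr_of_eventuallyEq ?_
    filter_upwards [notMem_tsupport_iff_eventuallyEq.1 h0] with s hs
    simp [hs]
  · exact hu.1.contDiffAt.mul (Complex.ofRealCLM.contDiff.contDiffAt.inv (by simpa using ht))

/-- The support of a function in `C_c²((0,∞))` lies in a compact subinterval. -/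
lemma exists_tsupport_subset_Icc (hf : CcTwo f) :
    ∃ c d : ℝ, 0 < c ∧ c ≤ d ∧ tsupport f ⊆ Icc c d := by
  rcases (tsupport f).eq_empty_or_nonempty with h | h
  · exact ⟨1, 1, one_pos, le_rfl, by simp [h]⟩
  · have hc : IsCompact (tsupport f) := hf.2.1
    have hinf := hc.sInf_mem h
    exact ⟨sInf (tsupport f), sSup (tsupport f), hf.2.2 hinf,
      csInf_le hc.bddBelow (hc.sSup_mem h),
      fun x hx => ⟨csInf_le hc.bddBelow hx, le_csSup hc.bddAbove hx⟩⟩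

lemma tsupport_iteratedDeriv_subset (f : ℝ → ℂ) (n : ℕ) :
    tsupport (iteratedDeriv n f) ⊆ tsupport f := by
  refine Subset.trans (closure_mono fun x hx => ?_) (tsupport_iteratedFDeriv_subset (𝕜 := ℝ) n)
  rw [Function.mem_support, ← norm_ne_zero_iff] at hx ⊢
  rwa [norm_iteratedFDeriv_eq_norm_iteratedDeriv]

lemma continuous_iteratedDeriv (hf : CcTwo f) {n : ℕ} (hn : n ≤ 2) :
    Continuous (iteratedDeriv n f) :=
  hf.1.continuous_iteratedDeriv n (by exact_mod_cast hn)

lemma hasCompactSupport_iteratedDeriv (hf : CcTwo f) (n : ℕ) :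
    HasCompactSupport (iteratedDeriv n f) :=
  hf.2.1.of_isClosed_subset (isClosed_tsupport _) (tsupport_iteratedDeriv_subset f n)

lemma exists_bound_iteratedDeriv (hf : CcTwo f) :
    ∃ M : ℝ, 0 ≤ M ∧ ∀ n ≤ 2, ∀ x, ‖iteratedDeriv n f x‖ ≤ M := by
  have h (n : ℕ) : ∃ C : ℝ, n ≤ 2 → ∀ x, ‖iteratedDeriv n f x‖ ≤ C := by
    by_cases hn : n ≤ 2
    · obtain ⟨C, hC⟩ := (hf.hasCompactSupport_iteratedDeriv n).exists_bound_of_continuous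
        (hf.continuous_iteratedDeriv hn)
      exact ⟨C, fun _ => hC⟩
    · exact ⟨0, fun h => absurd h hn⟩
  choose C hC using h
  refine ⟨∑ n ∈ Finset.range 3, |C n|, by positivity, fun n hn x => ?_⟩
  exact ((hC n hn x).trans (le_abs_self _)).trans
    (Finset.single_le_sum (f := fun n => |C n|) (fun _ _ => abs_nonneg _)
      (Finset.mem_range.2 (by omega)))

/-- Quadratic decay of the Fourier transform, with an explicit constant. -/
lemma norm_fourier_le (hf : CcTwo f) {c d M : ℝ} (hcd : c ≤ d) (hs : tsupport f ⊆ Icc c d)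
    (hM : ∀ n ≤ 2, ∀ x, ‖iteratedDeriv n f x‖ ≤ M) (b : ℝ) :
    ‖𝓕 f b‖ ≤ 2 * (M * (d - c)) * (1 + b ^ 2)⁻¹ := by
  have key (n : ℕ) (hn : n ≤ 2) : ‖𝓕 (iteratedDeriv n f) b‖ ≤ M * (d - c) := by
    have h0 : ∀ x ∉ Icc c d, ‖iteratedDeriv n f x‖ = 0 := fun x hx => by
      rw [image_eq_zero_of_notMem_tsupport
        fun h => hx (hs (tsupport_iteratedDeriv_subset f n h)), norm_zero]
    calc ‖𝓕 (iteratedDeriv n f) b‖ ≤ ∫ x, ‖iteratedDeriv n f x‖ :=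
          VectorFourier.norm_fourierIntegral_le_integral_norm _ _ _ _ _
      _ = ∫ x in Icc c d, ‖iteratedDeriv n f x‖ :=
          (setIntegral_eq_integral_of_forall_compl_eq_zero h0).symm
      _ ≤ ∫ _ in Icc c d, M :=
          setIntegral_mono (hf.continuous_iteratedDeriv hn).norm.integrableOn_Icc
            continuous_const.integrableOn_Icc (hM n hn)
      _ = M * (d - c) := by
          rw [setIntegral_const, smul_eq_mul, measureReal_def, Real.volume_Icc,
            ENNReal.toReal_ofReal (sub_nonneg.2 hcd), mul_comm]
  have k0 := key 0 (by omega)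
  have k2 := key 2 le_rfl
  rw [iteratedDeriv_zero] at k0
  rw [Real.fourier_iteratedDeriv (N := 2) (by exact_mod_cast hf.1) (fun n hn =>
    (hf.continuous_iteratedDeriv (by exact_mod_cast hn)).integrable_of_hasCompactSupport
      (hf.hasCompactSupport_iteratedDeriv n)) (by norm_num)] at k2
  rw [norm_smul, norm_pow] at k2
  simp only [norm_mul, Complex.norm_ofNat, Complex.norm_real, Complex.norm_I, Real.norm_eq_abs,
    abs_of_pos Real.pi_pos, mul_one, mul_pow, sq_abs] at k2
  rw [← div_eq_mul_inv, le_div_iff₀ (by positivity)]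
  have hpi : 1 ≤ 2 ^ 2 * Real.pi ^ 2 := by nlinarith [Real.pi_gt_three]
  nlinarith [norm_nonneg (𝓕 f b), mul_nonneg (sq_nonneg b) (norm_nonneg (𝓕 f b))]

lemma integrable_fourier (hf : CcTwo f) : Integrable (𝓕 f) := by
  obtain ⟨c, d, -, hcd, hs⟩ := hf.exists_tsupport_subset_Icc
  obtain ⟨M, -, hM⟩ := hf.exists_bound_iteratedDeriv
  refine (integrable_inv_one_add_sq.const_mul (2 * (M * (d - c)))).mono' ?_
    (Filter.Eventually.of_forall (hf.norm_fourier_le hcd hs hM))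
  exact (VectorFourier.fourierIntegral_continuous Real.continuous_fourierChar continuous_inner
    hf.integrable).aestronglyMeasurable

/-- Functions in `C_c²((0,∞))` have Fourier transforms in a Hardy space, so the product of two
such transforms has vanishing integral. -/
lemma integral_fourier_mul_fourier (hu : CcTwo u) (hv : CcTwo v) :
    ∫ b, 𝓕 u b * 𝓕 v b = 0 := by
  have h := VectorFourier.integral_fourierIntegral_smul_eq_flip (L := innerₗ ℝ)
    (μ := volume) (ν := volume) (f := u) (g := 𝓕 v)
    Real.continuous_fourierChar continuous_inner hu.integrable hv.integrable_fourier
  have hinv := hv.continuous.fourierInv_fourier_eq hv.integrable hv.integrable_fourier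
  have hflip (t : ℝ) : VectorFourier.fourierIntegral Real.fourierChar volume
      (innerₗ ℝ).flip (𝓕 v) t = v (-t) := by
    rw [flip_innerₗ, ← congrFun hinv (-t), Real.fourierInv_eq_fourier_neg, neg_neg]
    rfl
  simp only [hflip, smul_eq_mul] at h
  refine Eq.trans h ?_
  refine integral_eq_zero_of_ae (Filter.Eventually.of_forall fun t => ?_)
  rcases le_total t 0 with ht | ht
  · simp [hu.eq_zero_of_nonpos ht]
  · simp [hv.eq_zero_of_nonpos (neg_nonpos.2 ht)]

/-- The Fourier transform of the slices `t ↦ u t * v (a t)` decays quadratically, uniformly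
in `a > 0`, and vanishes for `a` outside a compact subset of `(0,∞)`. -/
lemma exists_norm_fourier_slice_le (hu : CcTwo u) (hv : CcTwo v) :
    ∃ α β K : ℝ, 0 < α ∧ 0 ≤ K ∧ ∀ a, 0 < a → ∀ b,
      ‖𝓕 (fun t => u t * v (a * t)) b‖ ≤
        (1 + b ^ 2)⁻¹ * (Icc α β).indicator (fun _ => K) a := by
  obtain ⟨c, d, hc, hcd, hs⟩ := hu.exists_tsupport_subset_Icc
  obtain ⟨c', d', hc', hcd', hs'⟩ := hv.exists_tsupport_subset_Icc
  obtain ⟨M, hM0, hM⟩ := hu.exists_bound_iteratedDeriv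
  obtain ⟨M', hM0', hM'⟩ := hv.exists_bound_iteratedDeriv
  have hd := hc.trans_le hcd
  set B : ℝ := 1 + d' / c with hB
  have hB1 : 1 ≤ B := by have := hc'.le.trans hcd'; rw [hB]; simp; positivity
  set N : ℝ := 4 * (M * (B ^ 2 * M')) with hN
  refine ⟨c' / d, d' / c, 2 * (N * (d - c)), by positivity,
    by have := sub_nonneg.2 hcd; positivity, fun a ha b => ?_⟩
  by_cases haI : a ∈ Icc (c' / d) (d' / c)
  · rw [indicator_of_mem haI, mul_comm]
    refine (hu.mul_slice hv a).norm_fourier_le hcd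
      ((tsupport_mul_subset_left).trans hs) (fun n hn x => ?_) b
    have hva : ContDiff ℝ 2 fun t => v (a * t) := hv.1.comp (contDiff_const.mul contDiff_id)
    have hb (i : ℕ) (hi : i ≤ 2) : ‖iteratedDeriv i (fun t => v (a * t)) x‖ ≤ B ^ 2 * M' := by
      rw [iteratedDeriv_comp_const_smul (hv.1.of_le (by exact_mod_cast hi)), norm_smul, norm_pow,
        Real.norm_of_nonneg ha.le]
      have haB : a ≤ B := by have := haI.2; linarith
      have h1 : a ^ i ≤ B ^ 2 :=
        (pow_le_pow_left₀ ha.le haB i).trans (pow_le_pow_right₀ hB1 hi)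
      exact mul_le_mul h1 (hM' i hi _) (norm_nonneg _) (by positivity)
    rw [← norm_iteratedFDeriv_eq_norm_iteratedDeriv]
    refine (norm_iteratedFDeriv_mul_le hu.1 hva x (n := n)
      (by exact_mod_cast hn)).trans ?_
    simp only [norm_iteratedFDeriv_eq_norm_iteratedDeriv]
    calc _ ≤ ∑ i ∈ Finset.range (n + 1), (n.choose i : ℝ) * (M * (B ^ 2 * M')) := by
          refine Finset.sum_le_sum fun i hi => ?_
          rw [mul_assoc]
          have hi' : i ≤ n := by simpa [Nat.lt_succ_iff] using hi
          gcongr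
          · exact hM i (hi'.trans hn) x
          · exact hb _ ((Nat.sub_le _ _).trans hn)
      _ = 2 ^ n * (M * (B ^ 2 * M')) := by
          rw [← Finset.sum_mul, ← Nat.cast_sum, Nat.sum_range_choose, Nat.cast_pow,
            Nat.cast_ofNat]
      _ ≤ N := by
          rw [hN]
          gcongr
          calc (2 : ℝ) ^ n ≤ 2 ^ 2 := pow_le_pow_right₀ one_le_two hn
            _ = 4 := by norm_num
  · have h0 : (fun t => u t * v (a * t)) = fun _ => 0 := by
      ext t
      by_contra hne
      have ht := hs (subset_tsupport _ (left_ne_zero_of_mul hne))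
      have hat := hs' (subset_tsupport _ (right_ne_zero_of_mul hne))
      refine haI ⟨?_, ?_⟩
      · rw [div_le_iff₀ hd]
        exact hat.1.trans (mul_le_mul_of_nonneg_left ht.2 ha.le)
      · rw [le_div_iff₀ hc]
        exact (mul_le_mul_of_nonneg_left ht.1 ha.le).trans hat.2
    rw [indicator_of_notMem haI, h0, Real.fourier_real_eq]
    simp

lemma continuous_fourier_slice (hu : CcTwo u) (hv : CcTwo v) :
    Continuous fun p : ℝ × ℝ => 𝓕 (fun t => u t * v (p.2 * t)) p.1 := by
  have hu' := hu.continuous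
  have hv' := hv.continuous
  have h : Continuous fun p : ℝ × ℝ => ∫ t in tsupport u,
      Complex.exp (↑(-2 * Real.pi * t * p.1) * Complex.I) • (u t * v (p.2 * t)) := by
    refine continuous_parametric_integral_of_continuous ?_ hu.2.1
    simp only [Function.uncurry_def]
    fun_prop
  convert h using 2 with p
  rw [Real.fourier_real_eq_integral_exp_smul]
  refine (setIntegral_eq_integral_of_forall_compl_eq_zero fun t ht => ?_).symm
  simp [image_eq_zero_of_notMem_tsupport ht]

end CcTwo

variable {ξ η ξ₁ η₁ ξ₂ η₂ : ℝ → ℂ}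

lemma coeffP_eq_fourier (hη : CcTwo η) (a : ℝ) :
    (fun b => coeffP ξ η b a) =
      𝓕 fun t : ℝ => starRingEnd ℂ (η t) * (t : ℂ)⁻¹ * ξ (a * t) := by
  ext b
  rw [coeffP, Real.fourier_real_eq_integral_exp_smul,
    setIntegral_eq_integral_of_forall_compl_eq_zero]
  · congr 1 with t
    rw [smul_eq_mul]
    have : -(2 * Real.pi * b * t) = -2 * Real.pi * t * b := by ring
    rw [← Complex.ofReal_neg, this]
    ring
  · intro t ht
    simp [hη.eq_zero_of_nonpos (not_lt.1 ht)]

lemma deriv_coeffP (hξ : CcTwo ξ) (hη : CcTwo η) (a b : ℝ) :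
    deriv (fun b => coeffP ξ η b a) b =
      -(2 * (Real.pi : ℂ) * Complex.I) * 𝓕 (fun t => starRingEnd ℂ (η t) * ξ (a * t)) b := by
  have hg := hη.conj.mul_inv.mul_slice hξ a
  have hfun : (fun t : ℝ => (-2 * Real.pi * Complex.I * t) •
        (starRingEnd ℂ (η t) * (t : ℂ)⁻¹ * ξ (a * t))) =
      (-(2 * (Real.pi : ℂ) * Complex.I)) • fun t : ℝ => starRingEnd ℂ (η t) * ξ (a * t) := by
    ext t
    rcases eq_or_ne t 0 with rfl | ht
    · simp [hη.eq_zero_of_nonpos le_rfl]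
    · have : (t : ℂ) ≠ 0 := by exact_mod_cast ht
      simp only [smul_eq_mul, Pi.smul_apply]
      field_simp
  have hint : Integrable fun t : ℝ => t • (starRingEnd ℂ (η t) * (t : ℂ)⁻¹ * ξ (a * t)) :=
    (continuous_id.smul hg.continuous).integrable_of_hasCompactSupport hg.2.1.smul_left
  rw [coeffP_eq_fourier hη, Real.deriv_fourier hg.integrable hint, hfun,
    Real.fourier_real_eq_integral_exp_smul, Real.fourier_real_eq_integral_exp_smul,
    ← integral_const_mul]
  congr 1 with t
  simp only [smul_eq_mul, Pi.smul_apply]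
  ring

/-- The density of the `₊` pairing in terms of Fourier transforms. -/
lemma pairing_density_coeffP (hξ₁ : CcTwo ξ₁) (hη₁ : CcTwo η₁) (hη₂ : CcTwo η₂) (b a : ℝ) :
    (-(2 * (Real.pi : ℂ) * Complex.I)⁻¹ * (a : ℂ) * deriv (fun b : ℝ => coeffP ξ₁ η₁ b a) b)
        * coeffP ξ₂ η₂ b a =
      a * (𝓕 (fun t => starRingEnd ℂ (η₁ t) * ξ₁ (a * t)) b *
        𝓕 (fun t : ℝ => starRingEnd ℂ (η₂ t) * (t : ℂ)⁻¹ * ξ₂ (a * t)) b) := by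
  rw [deriv_coeffP hξ₁ hη₁, ← coeffP_eq_fourier hη₂ (ξ := ξ₂)]
  have : 2 * (Real.pi : ℂ) * Complex.I ≠ 0 := by simp [Real.pi_ne_zero]
  field_simp

lemma integrable_muG_iff {F : ℝ × ℝ → ℂ} :
    Integrable F muG ↔ Integrable (fun p => (p.2 ^ 2)⁻¹ • F p)
      ((volume : Measure ℝ).prod ((volume : Measure ℝ).restrict (Ioi (0 : ℝ)))) := by
  rw [muG, integrable_withDensity_iff_integrable_smul' (by fun_prop)
    (Filter.Eventually.of_forall fun _ => ENNReal.ofReal_lt_top)]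
  simp only [ENNReal.toReal_ofReal (inv_nonneg.2 (sq_nonneg _))]

lemma integral_muG (F : ℝ × ℝ → ℂ) :
    ∫ p, F p ∂muG = ∫ p, (p.2 ^ 2)⁻¹ • F p
      ∂((volume : Measure ℝ).prod ((volume : Measure ℝ).restrict (Ioi (0 : ℝ)))) := by
  rw [muG, integral_withDensity_eq_integral_toReal_smul (by fun_prop)
    (Filter.Eventually.of_forall fun _ => ENNReal.ofReal_lt_top)]
  simp only [ENNReal.toReal_ofReal (inv_nonneg.2 (sq_nonneg _))]

lemma integrable_pairing_coeffP (hξ₁ : CcTwo ξ₁) (hη₁ : CcTwo η₁) (hξ₂ : CcTwo ξ₂)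
    (hη₂ : CcTwo η₂) :
    Integrable (fun p : ℝ × ℝ =>
      (-(2 * (Real.pi : ℂ) * Complex.I)⁻¹ * (p.2 : ℂ)
          * deriv (fun b : ℝ => coeffP ξ₁ η₁ b p.2) p.1)
        * coeffP ξ₂ η₂ p.1 p.2) muG := by
  simp only [pairing_density_coeffP hξ₁ hη₁ hη₂]
  rw [integrable_muG_iff]
  obtain ⟨α, β, K, hα, hK, hb⟩ := hη₁.conj.exists_norm_fourier_slice_le hξ₁
  obtain ⟨α', β', K', -, hK', hb'⟩ := hη₂.conj.mul_inv.exists_norm_fourier_slice_le hξ₂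
  have hdom : Integrable (fun p : ℝ × ℝ =>
      (1 + p.1 ^ 2)⁻¹ * (Icc α β).indicator (fun _ => α⁻¹ * (K * K')) p.2)
      ((volume : Measure ℝ).prod ((volume : Measure ℝ).restrict (Ioi (0 : ℝ)))) := by
    refine integrable_inv_one_add_sq.mul_prod (Integrable.restrict ?_)
    rw [integrable_indicator_iff measurableSet_Icc]
    exact continuous_const.integrableOn_Icc
  refine hdom.mono' ?_ ?_
  · have h₁ := hη₁.conj.continuous_fourier_slice hξ₁
    have h₂ := hη₂.conj.mul_inv.continuous_fourier_slice hξ₂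
    refine AEStronglyMeasurable.smul
      (f := fun p : ℝ × ℝ => (p.2 ^ 2)⁻¹) (by fun_prop : Measurable _).aestronglyMeasurable ?_
    exact ((Complex.continuous_ofReal.comp continuous_snd).mul (h₁.mul h₂)).aestronglyMeasurable
  · have hpos : ∀ᵐ p : ℝ × ℝ ∂((volume : Measure ℝ).prod
        ((volume : Measure ℝ).restrict (Ioi (0 : ℝ)))), 0 < p.2 :=
      Measure.quasiMeasurePreserving_snd.ae (ae_restrict_mem measurableSet_Ioi)
    filter_upwards [hpos] with ⟨b, a⟩ ha
    simp only at ha ⊢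
    have h₁ := hb a ha b
    have h₂ : ‖𝓕 (fun t : ℝ => starRingEnd ℂ (η₂ t) * (t : ℂ)⁻¹ * ξ₂ (a * t)) b‖ ≤ K' := by
      refine (hb' a ha b).trans ?_
      calc _ ≤ 1 * K' := by
            gcongr
            · exact indicator_nonneg (fun _ _ => hK') _
            · exact inv_le_one_of_one_le₀ (by nlinarith [sq_nonneg b])
            · exact indicator_le_self' (fun _ _ => hK') _
        _ = K' := one_mul _
    rw [norm_smul, norm_mul, norm_mul, Complex.norm_real, Real.norm_of_nonneg ha.le,
      Real.norm_of_nonneg (by positivity), ← mul_assoc]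
    have ha2 : (a ^ 2)⁻¹ * a = a⁻¹ := by field_simp
    rw [ha2]
    by_cases haI : a ∈ Icc α β
    · rw [indicator_of_mem haI] at h₁ ⊢
      calc _ ≤ α⁻¹ * ((1 + b ^ 2)⁻¹ * K * K') := by
            gcongr
            exact haI.1
        _ = _ := by ring
    · rw [indicator_of_notMem haI, mul_zero] at h₁ ⊢
      rw [le_antisymm h₁ (norm_nonneg _)]
      simp

lemma integral_pairing_coeffP (hξ₁ : CcTwo ξ₁) (hη₁ : CcTwo η₁) (hξ₂ : CcTwo ξ₂)
    (hη₂ : CcTwo η₂) :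
    ∫ p : ℝ × ℝ, (-(2 * (Real.pi : ℂ) * Complex.I)⁻¹ * (p.2 : ℂ)
          * deriv (fun b : ℝ => coeffP ξ₁ η₁ b p.2) p.1)
        * coeffP ξ₂ η₂ p.1 p.2 ∂muG = 0 := by
  have hint := integrable_pairing_coeffP hξ₁ hη₁ hξ₂ hη₂
  simp only [pairing_density_coeffP hξ₁ hη₁ hη₂] at hint ⊢
  rw [integral_muG, integral_prod_symm _ (integrable_muG_iff.1 hint)]
  refine integral_eq_zero_of_ae (Filter.Eventually.of_forall fun a => ?_)
  simp only [integral_smul, integral_const_mul, Pi.zero_apply]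
  rw [(hη₁.conj.mul_slice hξ₁ a).integral_fourier_mul_fourier (hη₂.conj.mul_inv.mul_slice hξ₂ a)]
  simp

lemma coeffM_eq_conj_coeffP (ξ η : ℝ → ℂ) (b a : ℝ) :
    coeffM ξ η b a = starRingEnd ℂ
      (coeffP (fun t => starRingEnd ℂ (ξ t)) (fun t => starRingEnd ℂ (η t)) b a) := by
  rw [coeffM, coeffP, ← integral_conj]
  congr 1 with t
  simp only [map_mul, ← Complex.exp_conj, Complex.conj_conj, map_inv₀, Complex.conj_ofReal,
    Complex.conj_I, map_neg, neg_mul_neg]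

/-- Complex conjugation exchanges the `₊` and `₋` pairings, up to sign. -/
lemma pairing_density_coeffM (ξ₁ η₁ ξ₂ η₂ : ℝ → ℂ) (b a : ℝ) :
    (-(2 * (Real.pi : ℂ) * Complex.I)⁻¹ * (a : ℂ) * deriv (fun b : ℝ => coeffM ξ₁ η₁ b a) b)
        * coeffM ξ₂ η₂ b a =
      -starRingEnd ℂ ((-(2 * (Real.pi : ℂ) * Complex.I)⁻¹ * (a : ℂ) *
          deriv (fun b : ℝ => coeffP (fun t => starRingEnd ℂ (ξ₁ t))
            (fun t => starRingEnd ℂ (η₁ t)) b a) b)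
        * coeffP (fun t => starRingEnd ℂ (ξ₂ t)) (fun t => starRingEnd ℂ (η₂ t)) b a) := by
  simp only [coeffM_eq_conj_coeffP, starRingEnd_apply, deriv.star]
  simp only [← starRingEnd_apply, map_mul, map_neg, map_inv₀, Complex.conj_ofReal,
    Complex.conj_I, map_ofNat, mul_neg, inv_neg, neg_mul, neg_neg]

/-- Vanishing of the pairing `D♭` on same-type coefficient functions (proof of
Proposition 4.8 of Choi–Ghandehari): for `ξᵢ, ηᵢ ∈ C_c²((0,∞))`,
`∫_G (-(2πi)⁻¹ a ∂_b (ξ₁ *₊ η₁)) (ξ₂ *₊ η₂) dμ = 0` and likewise with `₊` replaced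
by `₋` throughout. -/
theorem pairing_deriv_same_sign_vanishes (ξ₁ η₁ ξ₂ η₂ : ℝ → ℂ)
    (hξ₁ : CcTwo ξ₁) (hη₁ : CcTwo η₁) (hξ₂ : CcTwo ξ₂) (hη₂ : CcTwo η₂) :
    Integrable (fun p : ℝ × ℝ =>
      (-(2 * (Real.pi : ℂ) * Complex.I)⁻¹ * (p.2 : ℂ)
          * deriv (fun b : ℝ => coeffP ξ₁ η₁ b p.2) p.1)
        * coeffP ξ₂ η₂ p.1 p.2) muG ∧
    ∫ p, (-(2 * (Real.pi : ℂ) * Complex.I)⁻¹ * (p.2 : ℂ)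
          * deriv (fun b : ℝ => coeffP ξ₁ η₁ b p.2) p.1)
        * coeffP ξ₂ η₂ p.1 p.2 ∂muG = 0 ∧
    Integrable (fun p : ℝ × ℝ =>
      (-(2 * (Real.pi : ℂ) * Complex.I)⁻¹ * (p.2 : ℂ)
          * deriv (fun b : ℝ => coeffM ξ₁ η₁ b p.2) p.1)
        * coeffM ξ₂ η₂ p.1 p.2) muG ∧
    ∫ p, (-(2 * (Real.pi : ℂ) * Complex.I)⁻¹ * (p.2 : ℂ)
          * deriv (fun b : ℝ => coeffM ξ₁ η₁ b p.2) p.1)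
        * coeffM ξ₂ η₂ p.1 p.2 ∂muG = 0 := by
  refine ⟨integrable_pairing_coeffP hξ₁ hη₁ hξ₂ hη₂, integral_pairing_coeffP hξ₁ hη₁ hξ₂ hη₂,
    ?_, ?_⟩
  · simp only [pairing_density_coeffM]
    exact ((LinearIsometryEquiv.integrable_comp_iff Complex.conjLIE).2
      (integrable_pairing_coeffP hξ₁.conj hη₁.conj hξ₂.conj hη₂.conj)).neg
  · simp only [pairing_density_coeffM]
    rw [integral_neg, integral_conj,
      integral_pairing_coeffP hξ₁.conj hη₁.conj hξ₂.conj hη₂.conj, map_zero, neg_zero]
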